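/- The kernel of π equals the ℂ-span of the basis elements a_{I,J} with ℓ+1 ∈ J. -/

import Mathlib

namespace OSDisc

/-- Hyperplane index set: pairs (i,j) with 1 ≤ i < j, ℓ+1 ≤ j ≤ n. -/
def Idx (ℓ n : ℕ) : Type :=
  {p : ℕ × ℕ // 1 ≤ p.1 ∧ p.1 < p.2 ∧ ℓ + 1 ≤ p.2 ∧ p.2 ≤ n}

/-- The exterior algebra E over ℂ on the vector space with basis e_{i,j}. -/
abbrev E (ℓ n : ℕ) : Type := ExteriorAlgebra ℂ (Idx ℓ n →₀ ℂ)

/-- The generators e_{i,j} of E (junk value 0 for invalid indices). -/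
noncomputable def gen (ℓ n : ℕ) (i j : ℕ) : E ℓ n :=
  if h : 1 ≤ i ∧ i < j ∧ ℓ + 1 ≤ j ∧ j ≤ n then
    ExteriorAlgebra.ι ℂ (Finsupp.single (⟨(i, j), h⟩ : Idx ℓ n) (1 : ℂ))
  else 0

/-- Relations generating the Orlik-Solomon ideal. -/
def rel (ℓ n : ℕ) : E ℓ n → E ℓ n → Prop := fun x y =>
  y = 0 ∧
    ((∃ i j k, 1 ≤ i ∧ i < j ∧ j < k ∧ k ≤ n ∧ ℓ + 1 ≤ j ∧
        x = gen ℓ n i j * gen ℓ n i k - gen ℓ n i j * gen ℓ n j k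
            + gen ℓ n i k * gen ℓ n j k) ∨
      (∃ i j k, 1 ≤ i ∧ i < j ∧ j ≤ ℓ ∧ ℓ < k ∧ k ≤ n ∧
        x = gen ℓ n i k * gen ℓ n j k))

/-- The Orlik-Solomon algebra A = E/I of the discriminantal arrangement A_{n,ℓ}. -/
abbrev A (ℓ n : ℕ) : Type := RingQuot (rel ℓ n)

/-- The quotient map E → A. -/
noncomputable def projA (ℓ n : ℕ) : E ℓ n →ₐ[ℂ] A ℓ n := RingQuot.mkAlgHom ℂ (rel ℓ n)

/-- The generators a_{i,j} of A. -/
noncomputable def a (ℓ n : ℕ) (i j : ℕ) : A ℓ n := projA ℓ n (gen ℓ n i j)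

/-- The degree-q component E^q of the exterior algebra. -/
noncomputable def Edeg (ℓ n : ℕ) (q : ℕ) : Submodule ℂ (E ℓ n) :=
  (LinearMap.range (ExteriorAlgebra.ι ℂ : (Idx ℓ n →₀ ℂ) →ₗ[ℂ] E ℓ n)) ^ q

/-- A^q: the image in A of the degree-q component of E. -/
noncomputable def Adeg (ℓ n : ℕ) (q : ℕ) : Submodule ℂ (A ℓ n) :=
  (Edeg ℓ n q).map (projA ℓ n).toLinearMap

/-- The element a_{I,J}: the product of a_{f j, j} over j ∈ J in increasing order. -/
noncomputable def aIJ (ℓ n : ℕ) (J : Finset ℕ) (f : ℕ → ℕ) : A ℓ n :=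
  ((J.sort (· ≤ ·)).map fun j => a ℓ n (f j) j).prod

/-- ω_λ ∈ A¹. -/
noncomputable def omega (ℓ n : ℕ) (lam : ℕ × ℕ → ℂ) : A ℓ n :=
  ∑ j ∈ Finset.Icc (ℓ + 1) n, ∑ i ∈ Finset.Ico 1 j, lam (i, j) • a ℓ n i j

/-- ω_{k,λ} = Σ_{i=1}^{k−1} λ_{i,k}·a_{i,k}. -/
noncomputable def omegaK (ℓ n : ℕ) (lam : ℕ × ℕ → ℂ) (k : ℕ) : A ℓ n :=
  ∑ i ∈ Finset.Ico 1 k, lam (i, k) • a ℓ n i k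

section

variable {ℓ n : ℕ}

theorem a_of_not {i j : ℕ} (h : ¬(1 ≤ i ∧ i < j ∧ ℓ + 1 ≤ j ∧ j ≤ n)) : a ℓ n i j = 0 := by
  rw [a, gen, dif_neg h, map_zero]

theorem a_of_idx (p : Idx ℓ n) :
    projA ℓ n (ExteriorAlgebra.ι ℂ (Finsupp.single p 1)) = a ℓ n p.1.1 p.1.2 := by
  rw [a, gen, dif_pos p.2]
  rfl

theorem exists_gen_eq_ι (i j : ℕ) : ∃ v, gen ℓ n i j = ExteriorAlgebra.ι ℂ v := by
  unfold gen
  split_ifs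
  · exact ⟨_, rfl⟩
  · exact ⟨0, (map_zero _).symm⟩

theorem a_mul_self (i j : ℕ) : a ℓ n i j * a ℓ n i j = 0 := by
  obtain ⟨v, hv⟩ := exists_gen_eq_ι (ℓ := ℓ) (n := n) i j
  rw [a, ← map_mul, hv, ExteriorAlgebra.ι_sq_zero, map_zero]

theorem a_mul_swap (i j p q : ℕ) : a ℓ n i j * a ℓ n p q = -(a ℓ n p q * a ℓ n i j) := by
  obtain ⟨v, hv⟩ := exists_gen_eq_ι (ℓ := ℓ) (n := n) i j
  obtain ⟨w, hw⟩ := exists_gen_eq_ι (ℓ := ℓ) (n := n) p q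
  rw [a, a, ← map_mul, ← map_mul, ← map_neg, hv, hw,
    eq_neg_of_add_eq_zero_left (ExteriorAlgebra.ι_add_mul_swap v w)]

theorem projA_eq_zero_of_rel {x : E ℓ n} (h : rel ℓ n x 0) : projA ℓ n x = 0 := by
  rw [projA, RingQuot.mkAlgHom_rel ℂ h, map_zero]

/-- Both kinds of Orlik-Solomon relations in one formula. -/
theorem a_mul_a_of_lt {p i k : ℕ} (hpi : p < i) (hik : i < k) :
    a ℓ n p k * a ℓ n i k = a ℓ n p i * (a ℓ n i k - a ℓ n p k) := by
  by_cases hp : 1 ≤ p ∧ ℓ < k ∧ k ≤ n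
  · obtain ⟨hp, hk, hkn⟩ := hp
    by_cases hi : ℓ + 1 ≤ i
    · have := projA_eq_zero_of_rel (ℓ := ℓ) (n := n)
        ⟨rfl, Or.inl ⟨p, i, k, hp, hpi, hik, hkn, hi, rfl⟩⟩
      simp only [map_add, map_sub, map_mul] at this
      change a ℓ n p i * a ℓ n p k - a ℓ n p i * a ℓ n i k + a ℓ n p k * a ℓ n i k = 0 at this
      rw [eq_neg_of_add_eq_zero_right this, mul_sub, neg_sub]
    · have := projA_eq_zero_of_rel (ℓ := ℓ) (n := n)
        ⟨rfl, Or.inr ⟨p, i, k, hp, hpi, by omega, hk, hkn, rfl⟩⟩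
      rw [map_mul] at this
      rw [a_of_not (i := p) (j := i) (by omega), zero_mul]
      exact this
  · rw [a_of_not (i := p) (j := k) (by omega), zero_mul, sub_zero]
    by_cases hp0 : 1 ≤ p
    · rw [a_of_not (i := i) (j := k) (by omega), mul_zero]
    · rw [a_of_not (i := p) (j := i) (by omega), zero_mul]

theorem a_mul_a_bottom (i p : ℕ) : a ℓ n i (ℓ + 1) * a ℓ n p (ℓ + 1) = 0 := by
  have key : ∀ i p, i < p → a ℓ n i (ℓ + 1) * a ℓ n p (ℓ + 1) = 0 := by
    intro i p h
    by_cases hp : p < ℓ + 1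
    · rw [a_mul_a_of_lt h hp, a_of_not (i := i) (j := p) (by omega), zero_mul]
    · rw [a_of_not (i := p) (by omega), mul_zero]
  rcases lt_trichotomy i p with h | rfl | h
  · exact key i p h
  · exact a_mul_self _ _
  · rw [a_mul_swap, key p i h, neg_zero]

theorem adjoin_a : Algebra.adjoin ℂ {x : A ℓ n | ∃ i j, x = a ℓ n i j} = ⊤ := by
  rw [eq_top_iff]
  rintro x -
  obtain ⟨e, rfl⟩ : ∃ e, projA ℓ n e = x := RingQuot.mkAlgHom_surjective ℂ _ x
  induction e using ExteriorAlgebra.induction with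
  | algebraMap r => rw [AlgHom.commutes]; exact Subalgebra.algebraMap_mem _ r
  | mul x y hx hy => rw [map_mul]; exact mul_mem hx hy
  | add x y hx hy => rw [map_add]; exact add_mem hx hy
  | ι v =>
    induction v using Finsupp.induction_linear with
    | zero => rw [map_zero, map_zero]; exact zero_mem _
    | add v w hv hw => rw [map_add, map_add]; exact add_mem hv hw
    | single p c =>
      rw [← mul_one c, ← smul_eq_mul, ← Finsupp.smul_single, map_smul, map_smul, a_of_idx]
      refine Subalgebra.smul_mem _ (Algebra.subset_adjoin ?_) c
      exact ⟨_, _, rfl⟩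

/-- A subspace stable under right multiplication by the generators is stable under right
multiplication. -/
theorem mul_mem_of_a {S : Submodule ℂ (A ℓ n)} (h : ∀ i j, ∀ x ∈ S, x * a ℓ n i j ∈ S)
    (y : A ℓ n) : ∀ x ∈ S, x * y ∈ S := by
  have hy : y ∈ Algebra.adjoin ℂ {x : A ℓ n | ∃ i j, x = a ℓ n i j} := by
    rw [adjoin_a]; trivial
  induction hy using Algebra.adjoin_induction with
  | mem y hy => obtain ⟨i, j, rfl⟩ := hy; exact h i j
  | algebraMap r =>
    intro x hx
    rw [← Algebra.commutes, ← Algebra.smul_def]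
    exact S.smul_mem r hx
  | add y z _ _ hy hz => intro x hx; rw [mul_add]; exact add_mem (hy x hx) (hz x hx)
  | mul y z _ _ hy hz => intro x hx; rw [← mul_assoc]; exact hz _ (hy x hx)

theorem mul_mem_of_a_left {S : Submodule ℂ (A ℓ n)} (h : ∀ i j, ∀ x ∈ S, a ℓ n i j * x ∈ S)
    (y : A ℓ n) : ∀ x ∈ S, y * x ∈ S := by
  have hy : y ∈ Algebra.adjoin ℂ {x : A ℓ n | ∃ i j, x = a ℓ n i j} := by
    rw [adjoin_a]; trivial
  induction hy using Algebra.adjoin_induction with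
  | mem y hy => obtain ⟨i, j, rfl⟩ := hy; exact h i j
  | algebraMap r =>
    intro x hx
    rw [← Algebra.smul_def]
    exact S.smul_mem r hx
  | add y z _ _ hy hz => intro x hx; rw [add_mul]; exact add_mem (hy x hx) (hz x hx)
  | mul y z _ _ hy hz => intro x hx; rw [mul_assoc]; exact hy _ (hz x hx)

theorem aIJ_congr {J : Finset ℕ} {f g : ℕ → ℕ} (h : ∀ j ∈ J, f j = g j) :
    aIJ ℓ n J f = aIJ ℓ n J g := by
  unfold aIJ
  congr 1
  refine List.map_congr_left fun j hj => ?_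
  rw [h j ((Finset.mem_sort _).1 hj)]

theorem aIJ_insert_min {J : Finset ℕ} {m : ℕ} (f : ℕ → ℕ) (h : ∀ j ∈ J, m < j) :
    aIJ ℓ n (insert m J) f = a ℓ n (f m) m * aIJ ℓ n J f := by
  rw [aIJ, Finset.sort_insert _ (fun b hb => (h b hb).le) (fun hm => (h m hm).false),
    List.map_cons, List.prod_cons, aIJ]

theorem aIJ_insert_max {J : Finset ℕ} {m : ℕ} (f : ℕ → ℕ) (h : ∀ j ∈ J, j < m) :
    aIJ ℓ n (insert m J) f = aIJ ℓ n J f * a ℓ n (f m) m := by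
  have hm : m ∉ J := fun hm => (h m hm).false
  have : (insert m J).sort (· ≤ ·) = J.sort (· ≤ ·) ++ [m] := by
    refine List.Perm.eq_of_pairwise' (r := (· ≤ ·)) (Finset.pairwise_sort _ _) ?_ ?_
    · rw [List.pairwise_append]
      refine ⟨Finset.pairwise_sort _ _, List.pairwise_singleton _ _, ?_⟩
      intro x hx y hy
      rw [List.mem_singleton.1 hy]
      exact (h x ((Finset.mem_sort _).1 hx)).le
    · rw [List.perm_ext_iff_of_nodup (Finset.sort_nodup _ _)]
      · intro x
        simp [or_comm]
      · simpa [List.nodup_append, Finset.sort_nodup] using hm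
  rw [aIJ, this, List.map_append, List.prod_append, List.map_singleton, List.prod_singleton, aIJ]

/-- The span of the `a_{I,J}` with `J ⊆ {ℓ+1,…,k}`. -/
noncomputable def stdSpan (ℓ n k : ℕ) : Submodule ℂ (A ℓ n) :=
  Submodule.span ℂ {y | ∃ (J : Finset ℕ) (f : ℕ → ℕ), J ⊆ Finset.Icc (ℓ + 1) k ∧
    (∀ j ∈ J, 1 ≤ f j ∧ f j < j) ∧ y = aIJ ℓ n J f}

theorem one_mem_stdSpan (k : ℕ) : (1 : A ℓ n) ∈ stdSpan ℓ n k :=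
  Submodule.subset_span ⟨∅, id, by simp, by simp, by simp [aIJ]⟩

theorem stdSpan_mono {k m : ℕ} (h : k ≤ m) : stdSpan ℓ n k ≤ stdSpan ℓ n m := by
  refine Submodule.span_mono ?_
  rintro y ⟨J, f, hJ, hf, rfl⟩
  exact ⟨J, f, hJ.trans (Finset.Icc_subset_Icc_right h), hf, rfl⟩

theorem mul_a_succ_mem_stdSpan {k i : ℕ} {x : A ℓ n} (hx : x ∈ stdSpan ℓ n k) :
    x * a ℓ n i (k + 1) ∈ stdSpan ℓ n (k + 1) := by
  by_cases hi : 1 ≤ i ∧ i < k + 1 ∧ ℓ + 1 ≤ k + 1 ∧ k + 1 ≤ n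
  · induction hx using Submodule.span_induction with
    | zero => rw [zero_mul]; exact zero_mem _
    | add x y _ _ hx hy => rw [add_mul]; exact add_mem hx hy
    | smul c x _ hx => rw [smul_mul_assoc]; exact Submodule.smul_mem _ _ hx
    | mem x hx =>
      obtain ⟨J, f, hJ, hf, rfl⟩ := hx
      have hlt : ∀ j ∈ J, j < k + 1 := fun j hj => by
        have := Finset.mem_Icc.1 (hJ hj); omega
      refine Submodule.subset_span ⟨insert (k + 1) J, Function.update f (k + 1) i, ?_, ?_, ?_⟩
      · intro j hj
        rcases Finset.mem_insert.1 hj with rfl | hj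
        · exact Finset.mem_Icc.2 ⟨hi.2.2.1, le_rfl⟩
        · exact Finset.Icc_subset_Icc_right (Nat.le_succ k) (hJ hj)
      · intro j hj
        rcases Finset.mem_insert.1 hj with rfl | hj
        · rw [Function.update_self]; exact ⟨hi.1, hi.2.1⟩
        · rw [Function.update_of_ne (hlt j hj).ne]; exact hf j hj
      · rw [aIJ_insert_max _ hlt, Function.update_self]
        congr 1
        exact aIJ_congr fun j hj => (Function.update_of_ne (hlt j hj).ne _ _).symm
  · rw [a_of_not hi, mul_zero]; exact zero_mem _

theorem mul_a_mem_stdSpan (k : ℕ) :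
    ∀ i j, j ≤ k → ∀ x ∈ stdSpan ℓ n k, x * a ℓ n i j ∈ stdSpan ℓ n k := by
  induction k with
  | zero =>
    intro i j hj x _
    rw [a_of_not (by omega), mul_zero]
    exact zero_mem _
  | succ k ih =>
    intro i j hj x hx
    have low : ∀ i j, j ≤ k + 1 → ∀ x ∈ stdSpan ℓ n k, x * a ℓ n i j ∈ stdSpan ℓ n (k + 1) := by
      intro i j hj x hx
      rcases Nat.le_succ_iff.1 hj with hj | rfl
      · exact stdSpan_mono (Nat.le_succ k) (ih i j hj x hx)
      · exact mul_a_succ_mem_stdSpan hx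
    have top : ∀ p i, p < i → ∀ x ∈ stdSpan ℓ n k,
        x * (a ℓ n p (k + 1) * a ℓ n i (k + 1)) ∈ stdSpan ℓ n (k + 1) := by
      intro p i hpi x hx
      by_cases hik : i < k + 1
      · rw [a_mul_a_of_lt hpi hik, ← mul_assoc, mul_sub]
        have hx' := ih p i (by omega) x hx
        exact sub_mem (mul_a_succ_mem_stdSpan hx') (mul_a_succ_mem_stdSpan hx')
      · rw [a_of_not (i := i) (by omega), mul_zero, mul_zero]; exact zero_mem _
    induction hx using Submodule.span_induction with
    | zero => rw [zero_mul]; exact zero_mem _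
    | add x y _ _ hx hy => rw [add_mul]; exact add_mem hx hy
    | smul c x _ hx => rw [smul_mul_assoc]; exact Submodule.smul_mem _ _ hx
    | mem x hx =>
      obtain ⟨J, f, hJ, hf, rfl⟩ := hx
      have hsub : J.erase (k + 1) ⊆ Finset.Icc (ℓ + 1) k := fun m hm => by
        have hm := Finset.mem_erase.1 hm
        have := Finset.mem_Icc.1 (hJ hm.2)
        exact Finset.mem_Icc.2 (by omega)
      have hmem : aIJ ℓ n (J.erase (k + 1)) f ∈ stdSpan ℓ n k :=
        Submodule.subset_span ⟨_, f, hsub, fun m hm => hf m (Finset.mem_of_mem_erase hm), rfl⟩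
      by_cases hk : k + 1 ∈ J
      · rw [← Finset.insert_erase hk, aIJ_insert_max f fun m hm => by
          have := Finset.mem_Icc.1 (hsub hm); omega]
        generalize aIJ ℓ n (J.erase (k + 1)) f = x at hmem
        rw [mul_assoc]
        rcases Nat.le_succ_iff.1 hj with hj | rfl
        · rw [a_mul_swap, mul_neg, ← mul_assoc]
          exact neg_mem (mul_a_succ_mem_stdSpan (ih i j hj x hmem))
        · rcases lt_trichotomy (f (k + 1)) i with h | h | h
          · exact top _ _ h x hmem
          · rw [h, a_mul_self, mul_zero]; exact zero_mem _
          · rw [a_mul_swap, mul_neg]; exact neg_mem (top _ _ h x hmem)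
      · rw [Finset.erase_eq_of_notMem hk] at hmem
        exact low i j hj _ hmem

theorem stdSpan_eq_top : stdSpan ℓ n n = ⊤ := by
  rw [eq_top_iff]
  rintro x -
  rw [← one_mul x]
  refine mul_mem_of_a (fun i j x hx => ?_) x 1 (one_mem_stdSpan n)
  by_cases hj : j ≤ n
  · exact mul_a_mem_stdSpan n i j hj x hx
  · rw [a_of_not (by omega), mul_zero]; exact zero_mem _

/-- The span of the `a_{I,J}` with `ℓ+1 ∈ J`. -/
noncomputable def bottomSpan (ℓ n : ℕ) : Submodule ℂ (A ℓ n) :=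
  Submodule.span ℂ {y | ∃ (J : Finset ℕ) (f : ℕ → ℕ), J ⊆ Finset.Icc (ℓ + 1) n ∧
    (∀ j ∈ J, 1 ≤ f j ∧ f j < j) ∧ (ℓ + 1) ∈ J ∧ y = aIJ ℓ n J f}

theorem aIJ_of_bottom_mem {J : Finset ℕ} (hJ : J ⊆ Finset.Icc (ℓ + 1) n) (f : ℕ → ℕ)
    (h : ℓ + 1 ∈ J) :
    aIJ ℓ n J f = a ℓ n (f (ℓ + 1)) (ℓ + 1) * aIJ ℓ n (J.erase (ℓ + 1)) f := by
  conv_lhs => rw [← Finset.insert_erase h]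
  refine aIJ_insert_min f fun j hj => ?_
  have hj := Finset.mem_erase.1 hj
  have := Finset.mem_Icc.1 (hJ hj.2)
  omega

theorem a_bottom_mul_mem (i : ℕ) (y : A ℓ n) : a ℓ n i (ℓ + 1) * y ∈ bottomSpan ℓ n := by
  by_cases hi : 1 ≤ i ∧ i < ℓ + 1 ∧ ℓ + 1 ≤ ℓ + 1 ∧ ℓ + 1 ≤ n
  · have hy : y ∈ stdSpan ℓ n n := by rw [stdSpan_eq_top]; trivial
    induction hy using Submodule.span_induction with
    | zero => rw [mul_zero]; exact zero_mem _
    | add x y _ _ hx hy => rw [mul_add]; exact add_mem hx hy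
    | smul c x _ hx => rw [mul_smul_comm]; exact Submodule.smul_mem _ _ hx
    | mem y hy =>
      obtain ⟨J, f, hJ, hf, rfl⟩ := hy
      by_cases h : ℓ + 1 ∈ J
      · rw [aIJ_of_bottom_mem hJ f h, ← mul_assoc, a_mul_a_bottom, zero_mul]
        exact zero_mem _
      · have hlt : ∀ j ∈ J, ℓ + 1 < j := fun j hj =>
          lt_of_le_of_ne (Finset.mem_Icc.1 (hJ hj)).1 fun e => h (e ▸ hj)
        refine Submodule.subset_span ⟨insert (ℓ + 1) J, Function.update f (ℓ + 1) i, ?_, ?_,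
          Finset.mem_insert_self _ _, ?_⟩
        · exact Finset.insert_subset (Finset.mem_Icc.2 hi.2.2) hJ
        · intro j hj
          rcases Finset.mem_insert.1 hj with rfl | hj
          · rw [Function.update_self]; exact ⟨hi.1, hi.2.1⟩
          · rw [Function.update_of_ne (hlt j hj).ne']; exact hf j hj
        · rw [aIJ_insert_min _ hlt, Function.update_self]
          congr 1
          exact aIJ_congr fun j hj => (Function.update_of_ne (hlt j hj).ne' _ _).symm
  · rw [a_of_not hi, zero_mul]; exact zero_mem _

theorem bottomSpan_induction {P : A ℓ n → Prop} (zero : P 0)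
    (add : ∀ x y, P x → P y → P (x + y)) (smul : ∀ (c : ℂ) x, P x → P (c • x))
    (mul : ∀ i y, i ≤ ℓ → 1 ≤ i → P (a ℓ n i (ℓ + 1) * y)) :
    ∀ x ∈ bottomSpan ℓ n, P x := by
  intro x hx
  induction hx using Submodule.span_induction with
  | zero => exact zero
  | add x y _ _ hx hy => exact add x y hx hy
  | smul c x _ hx => exact smul c x hx
  | mem x hx =>
    obtain ⟨J, f, hJ, hf, h, rfl⟩ := hx
    rw [aIJ_of_bottom_mem hJ f h]
    exact mul _ _ (Nat.lt_succ_iff.1 (hf _ h).2) (hf _ h).1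

/-- `bottomSpan` as an ideal: it is the ideal generated by the `a_{i,ℓ+1}`. -/
noncomputable def bottomIdeal (ℓ n : ℕ) : Ideal (A ℓ n) where
  carrier := bottomSpan ℓ n
  add_mem' := add_mem
  zero_mem' := zero_mem _
  smul_mem' := by
    refine fun y x hx => mul_mem_of_a_left (S := bottomSpan ℓ n) (fun i j => ?_) y x hx
    refine bottomSpan_induction ?_ (fun x y hx hy => ?_) (fun c x hx => ?_) (fun p y _ _ => ?_)
    · rw [mul_zero]; exact zero_mem _
    · rw [mul_add]; exact add_mem hx hy
    · rw [mul_smul_comm]; exact Submodule.smul_mem _ _ hx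
    · rw [← mul_assoc, a_mul_swap, neg_mul, mul_assoc]
      exact neg_mem (a_bottom_mul_mem p _)

theorem mem_bottomIdeal {x : A ℓ n} : x ∈ bottomIdeal ℓ n ↔ x ∈ bottomSpan ℓ n := Iff.rfl

instance : (bottomIdeal ℓ n).IsTwoSided where
  mul_mem_of_left {x} b hx := by
    revert x
    change ∀ x ∈ bottomSpan ℓ n, x * b ∈ bottomSpan ℓ n
    refine bottomSpan_induction ?_ (fun x y hx hy => ?_) (fun c x hx => ?_) (fun p y _ _ => ?_)
    · rw [zero_mul]; exact zero_mem _
    · rw [add_mul]; exact add_mem hx hy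
    · rw [smul_mul_assoc]; exact Submodule.smul_mem _ _ hx
    · rw [mul_assoc]; exact a_bottom_mul_mem p _

/-- The index inclusion of the hyperplanes of `A_{n,ℓ+1}` into those of `A_{n,ℓ}`. -/
def Idx.incl (p : Idx (ℓ + 1) n) : Idx ℓ n :=
  ⟨p.1, p.2.1, p.2.2.1, by have := p.2.2.2.1; omega, p.2.2.2.2⟩

/-- The algebra map `E (ℓ+1) n → A ℓ n / (a_{i,ℓ+1})` sending `e_{i,j}` to the class of
`a_{i,j}`. -/
noncomputable def sectionE (ℓ n : ℕ) : E (ℓ + 1) n →ₐ[ℂ] A ℓ n ⧸ bottomIdeal ℓ n :=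
  ((Ideal.Quotient.mkₐ ℂ (bottomIdeal ℓ n)).comp (projA ℓ n)).comp
    (ExteriorAlgebra.map (Finsupp.lmapDomain ℂ ℂ Idx.incl))

theorem mk_a_bottom (i : ℕ) :
    Ideal.Quotient.mkₐ ℂ (bottomIdeal ℓ n) (a ℓ n i (ℓ + 1)) = 0 := by
  rw [Ideal.Quotient.mkₐ_eq_mk, Ideal.Quotient.eq_zero_iff_mem, mem_bottomIdeal,
    ← mul_one (a ℓ n i (ℓ + 1))]
  exact a_bottom_mul_mem i 1

theorem sectionE_ι (p : Idx (ℓ + 1) n) :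
    sectionE ℓ n (ExteriorAlgebra.ι ℂ (Finsupp.single p 1)) =
      Ideal.Quotient.mkₐ ℂ (bottomIdeal ℓ n) (a ℓ n p.1.1 p.1.2) := by
  rw [sectionE, AlgHom.comp_apply, AlgHom.comp_apply, ExteriorAlgebra.map_apply_ι,
    Finsupp.lmapDomain_apply, Finsupp.mapDomain_single, a_of_idx]
  rfl

theorem sectionE_gen (i j : ℕ) :
    sectionE ℓ n (gen (ℓ + 1) n i j) = Ideal.Quotient.mkₐ ℂ (bottomIdeal ℓ n) (a ℓ n i j) := by
  by_cases h : 1 ≤ i ∧ i < j ∧ ℓ + 1 + 1 ≤ j ∧ j ≤ n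
  · rw [gen, dif_pos h]
    exact sectionE_ι ⟨(i, j), h⟩
  · rw [gen, dif_neg h, map_zero]
    by_cases hj : j = ℓ + 1
    · rw [hj, mk_a_bottom]
    · rw [a_of_not (by omega), map_zero]

theorem sectionE_rel {x y : E (ℓ + 1) n} (h : rel (ℓ + 1) n x y) :
    sectionE ℓ n x = sectionE ℓ n y := by
  obtain ⟨rfl, ⟨i, j, k, hi, hij, hjk, hk, hj, rfl⟩ | ⟨i, j, k, hi, hij, hj, hk, hkn, rfl⟩⟩ := h
  · simp only [map_add, map_sub, map_mul, map_zero, sectionE_gen]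
    rw [← map_mul _ (a ℓ n i k) (a ℓ n j k), a_mul_a_of_lt hij hjk, map_mul, map_sub, mul_sub]
    abel
  · rw [map_mul, map_zero, sectionE_gen, sectionE_gen, ← map_mul, a_mul_a_of_lt hij (by omega),
      map_mul]
    by_cases h : j = ℓ + 1
    · rw [h, mk_a_bottom, zero_mul]
    · rw [a_of_not (i := i) (j := j) (by omega), map_zero, zero_mul]

/-- The algebra map `A (ℓ+1) n → A ℓ n / (a_{i,ℓ+1})` inverse to the one induced by `π`. -/
noncomputable def sectionA (ℓ n : ℕ) : A (ℓ + 1) n →ₐ[ℂ] A ℓ n ⧸ bottomIdeal ℓ n :=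
  RingQuot.liftAlgHom ℂ ⟨sectionE ℓ n, fun _ _ h => sectionE_rel h⟩

theorem sectionA_a (i j : ℕ) :
    sectionA ℓ n (a (ℓ + 1) n i j) = Ideal.Quotient.mkₐ ℂ (bottomIdeal ℓ n) (a ℓ n i j) := by
  rw [sectionA, a, projA, RingQuot.liftAlgHom_mkAlgHom_apply, sectionE_gen]

end

/-- The kernel of π : A → Â equals the ℂ-span of the basis elements a_{I,J}
    with ℓ+1 ∈ J. -/
theorem statement6 (ℓ n : ℕ) (hℓ : 1 ≤ ℓ) (hn : ℓ < n)
    (π : A ℓ n →ₐ[ℂ] A (ℓ + 1) n)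
    (hπ1 : ∀ i, 1 ≤ i → i ≤ ℓ → π (a ℓ n i (ℓ + 1)) = 0)
    (hπ2 : ∀ i j, ℓ + 2 ≤ j → j ≤ n → 1 ≤ i → i < j →
      π (a ℓ n i j) = a (ℓ + 1) n i j) :
    ∀ x : A ℓ n, π x = 0 ↔
      x ∈ Submodule.span ℂ
        {y : A ℓ n | ∃ (J : Finset ℕ) (f : ℕ → ℕ), J ⊆ Finset.Icc (ℓ + 1) n ∧
          (∀ j ∈ J, 1 ≤ f j ∧ f j < j) ∧ (ℓ + 1) ∈ J ∧ y = aIJ ℓ n J f} := by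
  have hcomp : (sectionA ℓ n).comp π = Ideal.Quotient.mkₐ ℂ (bottomIdeal ℓ n) := by
    refine AlgHom.ext_of_adjoin_eq_top adjoin_a ?_
    rintro _ ⟨i, j, rfl⟩
    rw [AlgHom.comp_apply]
    by_cases h : 1 ≤ i ∧ i < j ∧ ℓ + 1 ≤ j ∧ j ≤ n
    · by_cases hj : j = ℓ + 1
      · subst hj
        rw [hπ1 i h.1 (by omega), mk_a_bottom, map_zero]
      · rw [hπ2 i j (by omega) h.2.2.2 h.1 h.2.1, sectionA_a]
    · rw [a_of_not h, map_zero, map_zero, map_zero]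
  intro x
  change π x = 0 ↔ x ∈ bottomSpan ℓ n
  constructor
  · intro hx
    have := AlgHom.congr_fun hcomp x
    rw [AlgHom.comp_apply, hx, map_zero, Ideal.Quotient.mkₐ_eq_mk, eq_comm,
      Ideal.Quotient.eq_zero_iff_mem] at this
    exact this
  · revert x
    refine bottomSpan_induction (map_zero π) (fun x y hx hy => ?_) (fun c x hx => ?_)
      (fun i y hi hi' => ?_)
    · rw [map_add, hx, hy, add_zero]
    · rw [map_smul, hx, smul_zero]
    · rw [map_mul, hπ1 i hi' hi, zero_mul]

end OSDisc
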